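/- Let T = P ∪ R be a graceful labeling of a (1,2)-graph with one path component P of length k−1 and 2-regular part R with cycle lengths ℓ₁,…,ℓ_u, so V(T) = {0,…,a−1} and ΔT = {±1,…,±(a−1)} where a − 1 = k − 1 + ∑ℓᵢ. Let p₀, p₁ be the end-vertices of P, work in Z_{2a}, and let ℰ be the graph with edges {∞₁, p₀}, {∞₁, p₀ + a}, {p₁, p₁ + a}. Then 𝒞 = P ∪ (P + a) ∪ ℰ is a cycle of length 2k + 1 through ∞₁, and G = R ∪ (R + a) ∪ 𝒞 is a 2-regular graph on Z_{2a} ∪ {∞₁} with cycle structure {2k+1, ℓ₁, ℓ₁, …, ℓ_u, ℓ_u}. -/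

import Mathlib

/-- The cycle structure of a graph: the multiset of the orders (= lengths) of its
connected components all of whose vertices have degree 2 (its cycle components). -/
noncomputable def cycleStructure {V : Type*} [Finite V] (F : SimpleGraph V) : Multiset ℕ := by
  classical
  haveI : Fintype F.ConnectedComponent := Fintype.ofFinite _
  exact ((Finset.univ.filter fun c : F.ConnectedComponent =>
      ∀ v ∈ c.supp, (F.neighborSet v).ncard = 2).val.map fun c => c.supp.ncard)

/-- The translate `F + γ` of a graph on `Z_n ∪ {∞₁}`; the point `∞₁ = none` is fixed. -/
def translateO {n : ℕ} (F : SimpleGraph (Option (ZMod n))) (γ : ZMod n) :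
    SimpleGraph (Option (ZMod n)) :=
  F.map (Equiv.optionCongr (Equiv.addRight γ)).toEmbedding

/-- The image in `Z_n ∪ {∞₁}` of a graph on `ℤ` (labels reduced mod `n`). -/
def pushO (T : SimpleGraph ℤ) (n : ℕ) : SimpleGraph (Option (ZMod n)) :=
  SimpleGraph.fromRel
    (fun x y => ∃ u v : ℤ, T.Adj u v ∧ x = some ((u : ZMod n)) ∧ y = some ((v : ZMod n)))

/-- The vertex sets of the components of `F` all of whose vertices have degree 2. -/
def cycleSupports {V : Type*} (F : SimpleGraph V) : Set (Set V) :=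
  {S | ∃ v, S = {w | F.Reachable v w} ∧ ∀ w ∈ S, (F.neighborSet w).ncard = 2}

/-- Every vertex that is not isolated has degree 2. -/
def IsTwoRegularOnSupport {V : Type*} (F : SimpleGraph V) : Prop :=
  ∀ v ∈ F.support, (F.neighborSet v).ncard = 2

section CycleStructure

variable {V W : Type*}

theorem cycleStructure_eq_map_ncard [Finite V] (F : SimpleGraph V) :
    cycleStructure F = (Set.toFinite (cycleSupports F)).toFinset.val.map Set.ncard := by
  classical
  unfold cycleStructure
  let : Fintype F.ConnectedComponent := Fintype.ofFinite _
  have h : (Set.toFinite (cycleSupports F)).toFinset =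
      (Finset.univ.filter fun c : F.ConnectedComponent =>
        ∀ v ∈ c.supp, (F.neighborSet v).ncard = 2).map
          ⟨_, SimpleGraph.ConnectedComponent.supp_injective⟩ := by
    have hsupp : ∀ v, (F.connectedComponentMk v).supp = {w | F.Reachable v w} := fun v => by
      ext w
      simp [SimpleGraph.reachable_comm]
    ext S
    simp only [Set.Finite.mem_toFinset, cycleSupports, Set.mem_ofPred_eq, Finset.mem_map,
      Finset.mem_filter, Finset.mem_univ, true_and, Function.Embedding.coeFn_mk]
    constructor
    · rintro ⟨v, rfl, h⟩
      exact ⟨F.connectedComponentMk v, by rwa [hsupp], hsupp v⟩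
    · rintro ⟨c, h, rfl⟩
      induction c using SimpleGraph.ConnectedComponent.ind with
      | h v => exact ⟨v, hsupp v, h⟩
  rw [h, Finset.map_val, Multiset.map_map]
  rfl

theorem cycleSupports_map_equiv (e : V ≃ W) (F : SimpleGraph V) :
    cycleSupports (F.map e.toEmbedding) = Set.image e '' cycleSupports F := by
  have hreach : ∀ v, {w | (F.map e.toEmbedding).Reachable (e v) w} =
      e '' {w | F.Reachable v w} := fun v => by
    ext w
    obtain ⟨w, rfl⟩ := e.surjective w
    simpa using (SimpleGraph.Iso.map e F).reachable_iff (u := v) (v := w)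
  have hdeg : ∀ v, ((F.map e.toEmbedding).neighborSet (e v)).ncard = (F.neighborSet v).ncard :=
    fun v => by
      have := F.neighborSet_map e.toEmbedding v
      simp only [Equiv.coe_toEmbedding] at this ⊢
      rw [this, Set.ncard_image_of_injective _ e.injective]
  ext S
  constructor
  · rintro ⟨v, rfl, h⟩
    obtain ⟨v, rfl⟩ := e.surjective v
    refine ⟨_, ⟨v, rfl, fun w hw => ?_⟩, (hreach v).symm⟩
    rw [← hdeg]
    exact h _ (by rw [hreach]; exact ⟨w, hw, rfl⟩)
  · rintro ⟨_, ⟨v, rfl, h⟩, rfl⟩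
    refine ⟨e v, (hreach v).symm, ?_⟩
    rintro _ ⟨w, hw, rfl⟩
    rw [hdeg]
    exact h w hw

theorem cycleStructure_map_equiv [Finite V] [Finite W] (e : V ≃ W) (F : SimpleGraph V) :
    cycleStructure (F.map e.toEmbedding) = cycleStructure F := by
  classical
  rw [cycleStructure_eq_map_ncard, cycleStructure_eq_map_ncard]
  have h : (Set.toFinite (cycleSupports (F.map e.toEmbedding))).toFinset =
      (Set.toFinite (cycleSupports F)).toFinset.map
        ⟨_, Set.image_injective.mpr e.injective⟩ := by
    ext S
    rw [Set.Finite.mem_toFinset, cycleSupports_map_equiv]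
    simp
  rw [h, Finset.map_val, Multiset.map_map]
  exact Multiset.map_congr rfl fun S _ => Set.ncard_image_of_injective _ e.injective

theorem support_sup_eq (A B : SimpleGraph V) : (A ⊔ B).support = A.support ∪ B.support := by
  ext v
  simp [SimpleGraph.mem_support, exists_or]

theorem neighborSet_sup_of_notMem {A B : SimpleGraph V} {v : V} (hv : v ∉ B.support) :
    (A ⊔ B).neighborSet v = A.neighborSet v := by
  ext w
  simp only [SimpleGraph.mem_neighborSet, SimpleGraph.sup_adj, or_iff_left_iff_imp]
  exact fun h => (hv ⟨w, h⟩).elim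

theorem reachable_sup_iff {A B : SimpleGraph V} (hd : Disjoint A.support B.support) {v : V}
    (hv : v ∉ B.support) (w : V) : (A ⊔ B).Reachable v w ↔ A.Reachable v w := by
  refine ⟨?_, fun h => h.mono le_sup_left⟩
  rintro ⟨p⟩
  induction p with
  | nil => rfl
  | cons h p ih =>
    rename_i x y z
    have hA : A.Adj x y := h.resolve_right fun hB => hv ⟨y, hB⟩
    exact hA.reachable.trans (ih (Set.disjoint_left.mp hd ⟨x, hA.symm⟩))

theorem notMem_support_of_reachable {A B : SimpleGraph V} (hd : Disjoint A.support B.support)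
    {v w : V} (hv : v ∉ B.support) (h : A.Reachable v w) : w ∉ B.support := by
  obtain ⟨p⟩ := h
  induction p with
  | nil => exact hv
  | cons h p ih =>
    rename_i x y z
    exact ih (Set.disjoint_left.mp hd ⟨x, h.symm⟩)

theorem mem_support_of_ncard_neighborSet {F : SimpleGraph V} {v : V}
    (h : (F.neighborSet v).ncard = 2) : v ∈ F.support := by
  obtain ⟨w, hw⟩ := Set.nonempty_of_ncard_ne_zero (s := F.neighborSet v) (by omega)
  exact ⟨w, hw⟩

theorem subset_support_of_mem_cycleSupports {F : SimpleGraph V} {S : Set V}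
    (h : S ∈ cycleSupports F) : S ⊆ F.support := by
  obtain ⟨v, rfl, h⟩ := h
  exact fun w hw => mem_support_of_ncard_neighborSet (h w hw)

theorem nonempty_of_mem_cycleSupports {F : SimpleGraph V} {S : Set V}
    (h : S ∈ cycleSupports F) : S.Nonempty := by
  obtain ⟨v, rfl, h⟩ := h
  exact ⟨v, SimpleGraph.Reachable.refl v⟩

theorem forall_reachable_ncard_sup_iff {A B : SimpleGraph V} (hd : Disjoint A.support B.support)
    {v : V} (hv : v ∉ B.support) :
    (∀ w ∈ {w | (A ⊔ B).Reachable v w}, ((A ⊔ B).neighborSet w).ncard = 2) ↔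
      ∀ w ∈ {w | A.Reachable v w}, (A.neighborSet w).ncard = 2 := by
  refine forall_congr' fun w => ?_
  simp only [Set.mem_ofPred_eq, reachable_sup_iff hd hv]
  refine imp_congr_right fun hw => ?_
  rw [neighborSet_sup_of_notMem (notMem_support_of_reachable hd hv hw)]

theorem cycleSupports_subset_sup {A B : SimpleGraph V} (hd : Disjoint A.support B.support) :
    cycleSupports A ⊆ cycleSupports (A ⊔ B) := by
  rintro _ ⟨v, rfl, h⟩
  have hv : v ∉ B.support := Set.disjoint_left.mp hd
    (mem_support_of_ncard_neighborSet (h v (SimpleGraph.Reachable.refl v)))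
  have hS : {w | A.Reachable v w} = {w | (A ⊔ B).Reachable v w} :=
    Set.ext fun w => (reachable_sup_iff hd hv w).symm
  exact ⟨v, hS, hS ▸ (forall_reachable_ncard_sup_iff hd hv).mpr h⟩

theorem setOf_reachable_sup_mem_cycleSupports {A B : SimpleGraph V} (hd : Disjoint A.support B.support)
    {v : V} (hv : v ∉ B.support)
    (h : ∀ w ∈ {w | (A ⊔ B).Reachable v w}, ((A ⊔ B).neighborSet w).ncard = 2) :
    {w | (A ⊔ B).Reachable v w} ∈ cycleSupports A := by
  have hS : {w | (A ⊔ B).Reachable v w} = {w | A.Reachable v w} :=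
    Set.ext fun w => reachable_sup_iff hd hv w
  exact ⟨v, hS, hS ▸ (forall_reachable_ncard_sup_iff hd hv).mp h⟩

theorem cycleSupports_sup {A B : SimpleGraph V} (hd : Disjoint A.support B.support) :
    cycleSupports (A ⊔ B) = cycleSupports A ∪ cycleSupports B := by
  apply Set.Subset.antisymm
  · rintro _ ⟨v, rfl, h⟩
    by_cases hv : v ∈ B.support
    · have hv' := Set.disjoint_right.mp hd hv
      rw [sup_comm] at h ⊢
      exact Or.inr (setOf_reachable_sup_mem_cycleSupports hd.symm hv' h)
    · exact Or.inl (setOf_reachable_sup_mem_cycleSupports hd hv h)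
  · refine Set.union_subset (cycleSupports_subset_sup hd) ?_
    rw [sup_comm]
    exact cycleSupports_subset_sup hd.symm

theorem cycleStructure_sup [Finite V] {A B : SimpleGraph V}
    (hd : Disjoint A.support B.support) :
    cycleStructure (A ⊔ B) = cycleStructure A + cycleStructure B := by
  classical
  have hdisj : Disjoint (Set.toFinite (cycleSupports A)).toFinset
      (Set.toFinite (cycleSupports B)).toFinset := by
    rw [Finset.disjoint_left]
    intro S hA hB
    rw [Set.Finite.mem_toFinset] at hA hB
    obtain ⟨v, hv⟩ := nonempty_of_mem_cycleSupports hA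
    exact Set.disjoint_left.mp hd (subset_support_of_mem_cycleSupports hA hv)
      (subset_support_of_mem_cycleSupports hB hv)
  have h : (Set.toFinite (cycleSupports (A ⊔ B))).toFinset =
      (Set.toFinite (cycleSupports A)).toFinset.disjUnion
        (Set.toFinite (cycleSupports B)).toFinset hdisj := by
    ext S
    simp [cycleSupports_sup hd]
  rw [cycleStructure_eq_map_ncard, cycleStructure_eq_map_ncard A, cycleStructure_eq_map_ncard B,
    h, Finset.disjUnion_val, Multiset.map_add]

theorem IsTwoRegularOnSupport.sup {A B : SimpleGraph V} (hA : IsTwoRegularOnSupport A)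
    (hB : IsTwoRegularOnSupport B) (hd : Disjoint A.support B.support) :
    IsTwoRegularOnSupport (A ⊔ B) := by
  intro v hv
  rw [support_sup_eq] at hv
  rcases hv with hv | hv
  · rw [neighborSet_sup_of_notMem (Set.disjoint_left.mp hd hv)]
    exact hA v hv
  · rw [sup_comm, neighborSet_sup_of_notMem (Set.disjoint_right.mp hd hv)]
    exact hB v hv

theorem support_map_of_injOn {T : SimpleGraph V} {f : V → W} (hf : Set.InjOn f T.support) :
    (T.map f).support = f '' T.support := by
  ext x
  constructor
  · rintro ⟨y, -, u, v, h, rfl, rfl⟩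
    exact ⟨u, ⟨v, h⟩, rfl⟩
  · rintro ⟨u, ⟨v, h⟩, rfl⟩
    exact ⟨f v, fun he => h.ne (hf ⟨v, h⟩ ⟨u, h.symm⟩ he), u, v, h, rfl, rfl⟩

theorem IsTwoRegularOnSupport.map {T : SimpleGraph V} (hT : IsTwoRegularOnSupport T) {f : V → W}
    (hf : Set.InjOn f T.support) : IsTwoRegularOnSupport (T.map f) := by
  intro x hx
  rw [support_map_of_injOn hf] at hx
  obtain ⟨u, hu, rfl⟩ := hx
  have hnbr : (T.map f).neighborSet (f u) = f '' T.neighborSet u := by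
    ext y
    constructor
    · rintro ⟨-, u', v, h, hu', rfl⟩
      obtain rfl := hf ⟨v, h⟩ hu hu'
      exact ⟨v, h, rfl⟩
    · rintro ⟨v, h, rfl⟩
      exact ⟨fun he => h.ne (hf hu ⟨u, h.symm⟩ he), u, v, h, rfl, rfl⟩
  have hsub : T.neighborSet u ⊆ T.support := fun v h => ⟨u, h.symm⟩
  rw [hnbr, (hf.mono hsub).ncard_image]
  exact hT u hu

end CycleStructure

section SpanningCycle

variable {V : Type*} {C : SimpleGraph V} {z : V} {c : C.Walk z z}

theorem SimpleGraph.Walk.IsCycle.mem_support_iff_of_edges (hc : c.IsCycle)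
    (he : ∀ x y, C.Adj x y → s(x, y) ∈ c.edges) (v : V) : v ∈ C.support ↔ v ∈ c.support := by
  constructor
  · rintro ⟨w, h⟩
    exact c.fst_mem_support_of_mem_edges (he v w h)
  · intro hv
    obtain ⟨e, hec, hve⟩ := (c.mem_support_iff_exists_mem_edges_of_not_nil hc.not_nil).mp hv
    induction e with
    | _ x y =>
      have hxy := c.adj_of_mem_edges hec
      rcases Sym2.mem_iff.mp hve with rfl | rfl
      · exact ⟨y, hxy⟩
      · exact ⟨x, hxy.symm⟩

theorem SimpleGraph.Walk.IsCycle.isTwoRegularOnSupport_of_edges (hc : c.IsCycle)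
    (he : ∀ x y, C.Adj x y → s(x, y) ∈ c.edges) : IsTwoRegularOnSupport C := by
  intro v hv
  rw [← hc.ncard_neighborSet_toSubgraph_eq_two ((hc.mem_support_iff_of_edges he v).mp hv)]
  congr 1
  ext w
  rw [SimpleGraph.mem_neighborSet, SimpleGraph.Subgraph.mem_neighborSet,
    SimpleGraph.Walk.adj_toSubgraph_iff_mem_edges]
  exact ⟨he v w, c.adj_of_mem_edges⟩

theorem SimpleGraph.Walk.IsCycle.ncard_support (hc : c.IsCycle) :
    {v | v ∈ c.support}.ncard = c.length := by
  classical
  have h : {v | v ∈ c.support} = (c.support.tail.toFinset : Set V) := by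
    ext v
    simp only [Set.mem_ofPred_eq, List.coe_toFinset]
    rw [c.mem_support_iff]
    refine ⟨?_, Or.inr⟩
    rintro (rfl | h)
    · exact SimpleGraph.Walk.end_mem_tail_support hc.not_nil
    · exact h
  rw [h, Set.ncard_coe_finset, List.toFinset_card_of_nodup hc.support_nodup]
  simp

theorem SimpleGraph.Walk.IsCycle.cycleStructure_of_edges [Finite V] (hc : c.IsCycle)
    (he : ∀ x y, C.Adj x y → s(x, y) ∈ c.edges) : cycleStructure C = {c.length} := by
  classical
  have hz : ∀ v ∈ c.support, C.Reachable z v := fun v hv => ⟨c.takeUntil v hv⟩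
  have hmem := hc.mem_support_iff_of_edges he
  have hreg := hc.isTwoRegularOnSupport_of_edges he
  have hreach : ∀ v ∈ c.support, {w | C.Reachable v w} = {w | w ∈ c.support} := by
    intro v hv
    ext w
    refine ⟨fun h => ?_, fun hw => (hz v hv).symm.trans (hz w hw)⟩
    obtain ⟨p⟩ := h
    induction p with
    | nil => exact hv
    | cons h p ih => exact ih ((hmem _).mp ⟨_, h.symm⟩)
  have hsets : cycleSupports C = {{w | w ∈ c.support}} := by
    apply Set.Subset.antisymm
    · rintro _ ⟨v, rfl, h⟩
      exact hreach v ((hmem v).mp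
        (mem_support_of_ncard_neighborSet (h v (SimpleGraph.Reachable.refl v))))
    · rintro _ rfl
      exact ⟨z, (hreach z c.start_mem_support).symm, fun w hw => hreg w ((hmem w).mpr hw)⟩
  have hfin : (Set.toFinite (cycleSupports C)).toFinset = {{w | w ∈ c.support}} := by
    ext S
    simp [hsets]
  rw [cycleStructure_eq_map_ncard, hfin, Finset.singleton_val, Multiset.map_singleton,
    hc.ncard_support]

end SpanningCycle

/-- Two disjoint images of a path, with their last vertices joined by an edge and their first
vertices joined to a new vertex `z`, form a cycle. -/
theorem exists_isCycle_of_doubled_path {U V : Type*} {P : SimpleGraph U} {p₀ p₁ : U}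
    (w : P.Walk p₀ p₁) (hw : w.IsPath) (hPe : P.edgeSet = {e | e ∈ w.edges})
    (f g : U → V) (z : V) (hf : Set.InjOn f {v | v ∈ w.support})
    (hg : Set.InjOn g {v | v ∈ w.support})
    (hfg : ∀ x ∈ w.support, ∀ y ∈ w.support, f x ≠ g y) (hzf : ∀ x, z ≠ f x)
    (hzg : ∀ x, z ≠ g x) (C : SimpleGraph V)
    (hC : C = P.map f ⊔ P.map g ⊔
      SimpleGraph.fromEdgeSet {s(z, f p₀), s(z, g p₀), s(f p₁, g p₁)}) :
    ∃ c : C.Walk z z, c.IsCycle ∧ c.length = 2 * w.length + 3 ∧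
      ∀ x y, C.Adj x y → s(x, y) ∈ c.edges := by
  have hsupp : ∀ {x y}, P.Adj x y → x ∈ w.support := fun {x y} h => by
    have : s(x, y) ∈ P.edgeSet := h
    rw [hPe] at this
    exact w.fst_mem_support_of_mem_edges this
  have hCf : ∀ {x y}, P.Adj x y → C.Adj (f x) (f y) := fun {x y} h => by
    rw [hC]
    exact Or.inl (Or.inl (SimpleGraph.map_adj_apply' h
      fun he => h.ne (hf (hsupp h) (hsupp h.symm) he)))
  have hCg : ∀ {x y}, P.Adj x y → C.Adj (g x) (g y) := fun {x y} h => by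
    rw [hC]
    exact Or.inl (Or.inr (SimpleGraph.map_adj_apply' h
      fun he => h.ne (hg (hsupp h) (hsupp h.symm) he)))
  have hz0 : C.Adj z (f p₀) := by
    rw [hC]
    exact Or.inr ((SimpleGraph.fromEdgeSet_adj _).mpr ⟨by simp, hzf _⟩)
  have h0z : C.Adj (g p₀) z := by
    rw [hC]
    exact Or.inr ((SimpleGraph.fromEdgeSet_adj _).mpr ⟨by simp [Sym2.eq_swap], (hzg _).symm⟩)
  have h11 : C.Adj (f p₁) (g p₁) := by
    rw [hC]
    exact Or.inr ((SimpleGraph.fromEdgeSet_adj _).mpr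
      ⟨by simp, hfg _ w.end_mem_support _ w.end_mem_support⟩)
  let φ : P →g C := ⟨f, hCf⟩
  let ψ : P →g C := ⟨g, hCg⟩
  let q : C.Walk (f p₀) z := (w.map φ).append
    (SimpleGraph.Walk.cons h11 ((w.map ψ).reverse.append (SimpleGraph.Walk.cons h0z .nil)))
  have hqs : q.support = w.support.map f ++ ((w.support.map g).reverse ++ [z]) := by
    simp [q, SimpleGraph.Walk.support_append, φ, ψ]
  have hqe : q.edges = w.edges.map (Sym2.map f) ++
      s(f p₁, g p₁) :: ((w.edges.map (Sym2.map g)).reverse ++ [s(g p₀, z)]) := by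
    simp [q, SimpleGraph.Walk.edges_append, φ, ψ]
  have hq : q.IsPath := by
    rw [SimpleGraph.Walk.isPath_def, hqs]
    have hn := hw.support_nodup
    have h1 : (w.support.map f).Nodup := hn.map_on fun x hx y hy h => hf hx hy h
    have h2 : (w.support.map g).Nodup := hn.map_on fun x hx y hy h => hg hx hy h
    rw [List.nodup_append', List.nodup_append', List.nodup_reverse]
    refine ⟨h1, ⟨h2, List.nodup_singleton z, ?_⟩, ?_⟩
    · simp only [List.disjoint_singleton, List.mem_reverse, List.mem_map, not_exists, not_and]
      exact fun x _ h => hzg x h.symm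
    · intro v hv hv'
      obtain ⟨x, hx, rfl⟩ := List.mem_map.mp hv
      rcases List.mem_append.mp hv' with h | h
      · obtain ⟨y, hy, h⟩ := List.mem_map.mp (List.mem_reverse.mp h)
        exact hfg x hx y hy h.symm
      · exact hzf x (List.mem_singleton.mp h).symm
  refine ⟨SimpleGraph.Walk.cons hz0 q, ?_, ?_, ?_⟩
  · rw [SimpleGraph.Walk.cons_isCycle_iff, hqe]
    refine ⟨hq, fun h => ?_⟩
    have hnot : ∀ (F : U → V), (∀ x, z ≠ F x) → s(z, f p₀) ∉ w.edges.map (Sym2.map F) := by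
      intro F hF h
      obtain ⟨e, -, h⟩ := List.mem_map.mp h
      have hz : z ∈ Sym2.map F e := h ▸ Sym2.mem_mk_left _ _
      obtain ⟨x, -, hx⟩ := Sym2.mem_map.mp hz
      exact hF x hx.symm
    rcases List.mem_append.mp h with h | h
    · exact hnot f hzf h
    rcases List.mem_cons.mp h with h | h
    · rcases Sym2.eq_iff.mp h with ⟨h, -⟩ | ⟨h, -⟩
      · exact hzf _ h
      · exact hzg _ h
    rcases List.mem_append.mp h with h | h
    · exact hnot g hzg (List.mem_reverse.mp h)
    · rcases Sym2.eq_iff.mp (List.mem_singleton.mp h) with ⟨h, -⟩ | ⟨-, h⟩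
      · exact hzg _ h
      · exact hfg _ w.start_mem_support _ w.start_mem_support h
  · simp only [q, SimpleGraph.Walk.length_cons, SimpleGraph.Walk.length_append,
      SimpleGraph.Walk.length_reverse, SimpleGraph.Walk.length_map, SimpleGraph.Walk.length_nil]
    omega
  · intro x y h
    have hmap : ∀ (F : U → V) {x y}, (P.map F).Adj x y → s(x, y) ∈ w.edges.map (Sym2.map F) := by
      rintro F _ _ ⟨-, u, v, h, rfl, rfl⟩
      have : s(u, v) ∈ P.edgeSet := h
      rw [hPe] at this
      exact List.mem_map_of_mem (f := Sym2.map F) this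
    rw [SimpleGraph.Walk.edges_cons, hqe]
    rw [hC] at h
    rcases h with (h | h) | h
    · have := hmap f h
      simp only [List.mem_cons, List.mem_append]
      exact Or.inr (Or.inl this)
    · have := hmap g h
      simp only [List.mem_cons, List.mem_append, List.mem_reverse]
      exact Or.inr (Or.inr (Or.inr (Or.inl this)))
    · rcases ((SimpleGraph.fromEdgeSet_adj _).mp h).1 with h | h | h
      · simp [h]
      · rw [h, Sym2.eq_swap]
        simp
      · rw [Set.mem_singleton_iff.mp h]
        simp

theorem pushO_eq_map (T : SimpleGraph ℤ) (n : ℕ) :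
    pushO T n = T.map fun x : ℤ => some (x : ZMod n) := by
  ext x y
  simp only [pushO, SimpleGraph.fromRel_adj, SimpleGraph.map_adj']
  refine and_congr_right fun _ => ⟨?_, ?_⟩
  · rintro (⟨u, v, h, rfl, rfl⟩ | ⟨u, v, h, rfl, rfl⟩)
    · exact ⟨u, v, h, rfl, rfl⟩
    · exact ⟨v, u, h.symm, rfl, rfl⟩
  · rintro ⟨u, v, h, rfl, rfl⟩
    exact Or.inl ⟨u, v, h, rfl, rfl⟩

theorem translateO_pushO_eq_map (T : SimpleGraph ℤ) (n : ℕ) (γ : ZMod n) :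
    translateO (pushO T n) γ = T.map fun x : ℤ => some ((x : ZMod n) + γ) := by
  rw [translateO, pushO_eq_map, SimpleGraph.map_map]
  rfl

theorem ZMod.injOn_intCast_Ico (a : ℕ) :
    Set.InjOn (fun x : ℤ => (x : ZMod (2 * a))) {v : ℤ | 0 ≤ v ∧ v < (a : ℤ)} := by
  rintro x ⟨hx, hxa⟩ y ⟨hy, hya⟩ h
  have hdvd := (ZMod.intCast_eq_intCast_iff_dvd_sub x y (2 * a)).mp h
  have := Int.eq_zero_of_abs_lt_dvd hdvd (by rw [abs_lt]; push_cast; omega)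
  omega

theorem ZMod.intCast_ne_intCast_add_half {a : ℕ} {x y : ℤ}
    (hx : 0 ≤ x ∧ x < (a : ℤ)) (hy : 0 ≤ y ∧ y < (a : ℤ)) :
    (x : ZMod (2 * a)) ≠ (y : ZMod (2 * a)) + (a : ZMod (2 * a)) := by
  intro h
  have h' : ((x : ℤ) : ZMod (2 * a)) = ((y + a : ℤ) : ZMod (2 * a)) := by
    rw [h]
    push_cast
    rfl
  have hdvd := (ZMod.intCast_eq_intCast_iff_dvd_sub _ _ (2 * a)).mp h'
  have := Int.eq_zero_of_abs_lt_dvd hdvd (by rw [abs_lt]; push_cast; omega)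
  omega

theorem ZMod.exists_intCast_or_add_half (a : ℕ) [NeZero (2 * a)] (z : ZMod (2 * a)) :
    ∃ x : ℤ, (0 ≤ x ∧ x < (a : ℤ)) ∧
      (z = (x : ZMod (2 * a)) ∨ z = (x : ZMod (2 * a)) + (a : ZMod (2 * a))) := by
  have hlt := z.val_lt
  have hz : z = ((z.val : ℤ) : ZMod (2 * a)) := by simp
  by_cases h : z.val < a
  · exact ⟨z.val, by omega, Or.inl hz⟩
  · refine ⟨z.val - a, by omega, Or.inr ?_⟩
    push_cast
    simp

/-- The doubling construction: from a graceful labeling `T = P ∪ R` of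
`[k−1 | ℓ₁,…,ℓ_u]` on `{0,…,a−1}` (with `a = k + ∑ℓᵢ`), the graph
`𝒞 = P ∪ (P+a) ∪ ℰ` is a `(2k+1)`-cycle through `∞₁`, and
`G = R ∪ (R+a) ∪ 𝒞` is a 2-regular graph on `Z_{2a} ∪ {∞₁}` with cycle structure
`{2k+1, ℓ₁, ℓ₁, …, ℓ_u, ℓ_u}`. -/
theorem stmt10 (u k a : ℕ) [NeZero (2 * a)] (hu : 1 ≤ u) (hk : 1 ≤ k)
    (ℓ : Fin u → ℕ) (hℓ : ∀ i, 3 ≤ ℓ i) (ha : a = k + ∑ i, ℓ i)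
    (P R : SimpleGraph ℤ) (p₀ p₁ : ℤ)
    -- P is a path of length k−1 from p₀ to p₁
    (hP : ∃ w : P.Walk p₀ p₁, w.IsPath ∧ w.length = k - 1 ∧
      P.edgeSet = {e | e ∈ w.edges} ∧ P.support = {v | v ∈ w.support})
    -- R is 2-regular with cycle lengths ℓ₁,…,ℓ_u
    (hRreg : ∀ v ∈ R.support, (R.neighborSet v).ncard = 2)
    (hRcs : cycleStructure (pushO R (2 * a)) = Finset.univ.val.map ℓ)
    (hdisj : P.support ∩ R.support = ∅)
    -- T = P ∪ R is a graceful labeling: vertex set {0,…,a−1}, differences ±1,…,±(a−1)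
    (hV : (P ⊔ R).support = {v : ℤ | 0 ≤ v ∧ v < (a : ℤ)})
    (hΔ : {d : ℤ | ∃ x y : ℤ, (P ⊔ R).Adj x y ∧ x - y = d}
        = {d : ℤ | d ≠ 0 ∧ d.natAbs < a}) :
    -- ℰ, 𝒞 and G as in the construction
    ∀ E C G : SimpleGraph (Option (ZMod (2 * a))),
      E = SimpleGraph.fromEdgeSet
        {s((none : Option (ZMod (2 * a))), some ((p₀ : ZMod (2 * a)))),
         s((none : Option (ZMod (2 * a))), some ((p₀ : ZMod (2 * a)) + (a : ZMod (2 * a)))),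
         s(some ((p₁ : ZMod (2 * a))), some ((p₁ : ZMod (2 * a)) + (a : ZMod (2 * a))))} →
      C = pushO P (2 * a) ⊔ translateO (pushO P (2 * a)) ((a : ZMod (2 * a))) ⊔ E →
      G = pushO R (2 * a) ⊔ translateO (pushO R (2 * a)) ((a : ZMod (2 * a))) ⊔ C →
      (none ∈ C.support ∧ cycleStructure C = {2 * k + 1}) ∧
      (∀ v, (G.neighborSet v).ncard = 2) ∧
      cycleStructure G = (2 * k + 1) ::ₘ (Finset.univ.val.map ℓ + Finset.univ.val.map ℓ) := by
  rintro _ C G rfl hC hG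
  obtain ⟨w, hw, hlen, hPe, hPs⟩ := hP
  have hp₀ : p₀ ∈ P.support := by
    rw [hPs]
    exact w.start_mem_support
  have hk2 : 2 ≤ k := by
    by_contra hlt
    have hnil : w.edges = [] := List.length_eq_zero_iff.mp (by rw [w.length_edges]; omega)
    obtain ⟨y, hy⟩ := hp₀
    have : s(p₀, y) ∈ P.edgeSet := hy
    simp [hPe, hnil] at this
  set f : ℤ → Option (ZMod (2 * a)) := fun x => some (x : ZMod (2 * a)) with hf
  set g : ℤ → Option (ZMod (2 * a)) := fun x => some ((x : ZMod (2 * a)) + (a : ZMod (2 * a)))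
    with hg
  set I : Set ℤ := {v : ℤ | 0 ≤ v ∧ v < (a : ℤ)} with hI
  rw [support_sup_eq] at hV
  have hPI : P.support ⊆ I := hV ▸ Set.subset_union_left
  have hRI : R.support ⊆ I := hV ▸ Set.subset_union_right
  have hfI : Set.InjOn f I := fun x hx y hy h =>
    ZMod.injOn_intCast_Ico a hx hy (Option.some_injective _ h)
  have hgI : Set.InjOn g I := fun x hx y hy h =>
    ZMod.injOn_intCast_Ico a hx hy (add_right_cancel (Option.some_injective _ h))
  have hfg : ∀ x ∈ I, ∀ y ∈ I, f x ≠ g y := fun x hx y hy h =>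
    ZMod.intCast_ne_intCast_add_half hx hy (Option.some_injective _ h)
  have hwI : {v | v ∈ w.support} ⊆ I := hPs ▸ hPI
  rw [translateO_pushO_eq_map, pushO_eq_map] at hC
  obtain ⟨c, hc, hclen, hce⟩ := exists_isCycle_of_doubled_path w hw hPe f g none
    (hfI.mono hwI) (hgI.mono hwI) (fun x hx y hy => hfg x (hwI hx) y (hwI hy))
    (fun _ => by simp [hf]) (fun _ => by simp [hg]) C hC
  have hCcs : cycleStructure C = {2 * k + 1} := by
    rw [hc.cycleStructure_of_edges hce, hclen]
    congr 1
    omega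
  have hCreg := hc.isTwoRegularOnSupport_of_edges hce
  have hnone : none ∈ C.support :=
    (hc.mem_support_iff_of_edges hce none).mpr c.start_mem_support
  have hCsupp : C.support = {none} ∪ (f '' P.support ∪ g '' P.support) := by
    have hp₁ : p₁ ∈ P.support := by
      rw [hPs]
      exact w.end_mem_support
    rw [hC, support_sup_eq, support_sup_eq, support_map_of_injOn (hfI.mono hPI),
      support_map_of_injOn (hgI.mono hPI)]
    apply Set.Subset.antisymm
    · rintro x (hx | ⟨y, hy⟩)
      · exact Or.inr hx
      · have h := ((SimpleGraph.fromEdgeSet_adj _).mp hy).1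
        simp only [Set.mem_insert_iff, Set.mem_singleton_iff, Sym2.eq_iff] at h
        rcases h with (⟨rfl, -⟩ | ⟨rfl, -⟩) | (⟨rfl, -⟩ | ⟨rfl, -⟩) | ⟨rfl, -⟩ | ⟨rfl, -⟩
        · exact Or.inl rfl
        · exact Or.inr (Or.inl ⟨p₀, hp₀, rfl⟩)
        · exact Or.inl rfl
        · exact Or.inr (Or.inr ⟨p₀, hp₀, rfl⟩)
        · exact Or.inr (Or.inl ⟨p₁, hp₁, rfl⟩)
        · exact Or.inr (Or.inr ⟨p₁, hp₁, rfl⟩)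
    · rintro x (rfl | hx)
      · exact Or.inr ⟨f p₀, (SimpleGraph.fromEdgeSet_adj _).mpr ⟨by simp [hf], by simp [hf]⟩⟩
      · exact Or.inl hx
  have hcs₂ : cycleStructure (R.map g) = Finset.univ.val.map ℓ := by
    rw [← hRcs, ← translateO_pushO_eq_map, translateO, cycleStructure_map_equiv]
  rw [translateO_pushO_eq_map, pushO_eq_map] at hG
  rw [pushO_eq_map] at hRcs
  have hsf : (R.map f).support = f '' R.support := support_map_of_injOn (hfI.mono hRI)
  have hsg : (R.map g).support = g '' R.support := support_map_of_injOn (hgI.mono hRI)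
  have hd₁ : Disjoint (R.map f).support (R.map g).support := by
    rw [hsf, hsg, Set.disjoint_left]
    rintro _ ⟨x, hx, rfl⟩ ⟨y, hy, h⟩
    exact hfg x (hRI hx) y (hRI hy) h.symm
  have hPR : ∀ x ∈ P.support, x ∉ R.support := fun x hx hx' => by
    have : x ∈ P.support ∩ R.support := ⟨hx, hx'⟩
    simp [hdisj] at this
  have hd₂ : Disjoint (R.map f ⊔ R.map g).support C.support := by
    rw [support_sup_eq, hsf, hsg, hCsupp, Set.disjoint_left]
    rintro _ (⟨x, hx, rfl⟩ | ⟨x, hx, rfl⟩) (h | ⟨y, hy, h⟩ | ⟨y, hy, h⟩)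
    · cases h
    · exact hPR y hy (hfI (hPI hy) (hRI hx) h ▸ hx)
    · exact hfg x (hRI hx) y (hPI hy) h.symm
    · cases h
    · exact hfg y (hPI hy) x (hRI hx) h
    · exact hPR y hy (hgI (hPI hy) (hRI hx) h ▸ hx)
  have hGreg : IsTwoRegularOnSupport G := by
    rw [hG]
    exact ((IsTwoRegularOnSupport.map hRreg (hfI.mono hRI)).sup
      (IsTwoRegularOnSupport.map hRreg (hgI.mono hRI)) hd₁).sup hCreg hd₂
  refine ⟨⟨hnone, hCcs⟩, fun v => hGreg v ?_, ?_⟩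
  · rw [hG, support_sup_eq, support_sup_eq, hsf, hsg, hCsupp]
    rcases v with _ | z
    · exact Or.inr (Or.inl rfl)
    · obtain ⟨x, hx, hz⟩ := ZMod.exists_intCast_or_add_half a z
      have hx' : x ∈ P.support ∪ R.support := hV ▸ hx
      rcases hz with rfl | rfl <;> rcases hx' with hx' | hx'
      · exact Or.inr (Or.inr (Or.inl ⟨x, hx', rfl⟩))
      · exact Or.inl (Or.inl ⟨x, hx', rfl⟩)
      · exact Or.inr (Or.inr (Or.inr ⟨x, hx', rfl⟩))
      · exact Or.inl (Or.inr ⟨x, hx', rfl⟩)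
  · rw [hG, cycleStructure_sup hd₂, cycleStructure_sup hd₁, hRcs, hcs₂, hCcs, add_comm,
      Multiset.singleton_add]
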